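/- Assume λ is a replacement rule. Then for every d ≥ 0 the linear map ⊕_{a+b=d} A_a ⊗ B_b → P_d, induced by multiplication in P via the canonical algebra maps A → P and B → P (a ⊗ b ↦ a·b), is an isomorphism of vector spaces; hence the multiplication induces an isomorphism A ⊗ B ≅ P of weight-graded vector spaces. -/

import Mathlib

set_option linter.unusedSectionVars false

open TensorProduct

noncomputable section Quadratic

variable (k : Type) [Field k] [CharZero k]
variable (V : Type) [AddCommGroup V] [Module k V]

/-- Iterated tensor powers of `V`: `TP k V n = V^{⊗n}` (with `TP k V 0 = k`, `TP k V 1 = V`). -/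
def TP : ℕ → ModuleCat k
  | 0 => ModuleCat.of k k
  | 1 => ModuleCat.of k V
  | (n + 2) => ModuleCat.of k (↥(TP (n + 1)) ⊗[k] V)

/-- `V^{⊗n} ⊗ V ≅ V^{⊗(n+1)}`. -/
def stepEquiv : ∀ n : ℕ, (↥(TP k V n) ⊗[k] V) ≃ₗ[k] ↥(TP k V (n + 1))
  | 0 => TensorProduct.lid k V
  | (n + 1) => LinearEquiv.refl k ↥(TP k V (n + 2))

/-- The concatenation isomorphism `V^{⊗p} ⊗ V^{⊗q} ≅ V^{⊗(p+q)}`. -/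
def concatEquiv : ∀ p q : ℕ, (↥(TP k V p) ⊗[k] ↥(TP k V q)) ≃ₗ[k] ↥(TP k V (p + q))
  | p, 0 => TensorProduct.rid k ↥(TP k V p)
  | p, 1 => stepEquiv k V p
  | p, (q + 2) =>
      (TensorProduct.assoc k ↥(TP k V p) ↥(TP k V (q + 1)) V).symm.trans
        ((TensorProduct.congr (concatEquiv p (q + 1)) (LinearEquiv.refl k V)).trans
          (stepEquiv k V (p + (q + 1))))

/-- Transport of submodules along an equality of tensor-power indices. -/
def castTP {m n : ℕ} (h : m = n) (S : Submodule k ↥(TP k V m)) : Submodule k ↥(TP k V n) :=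
  h ▸ S

/-- For `S ⊆ V^{⊗p}` and `T ⊆ V^{⊗q}`, the subspace `S ⊗ T ⊆ V^{⊗(p+q)}`. -/
def concatSub {p q : ℕ} (S : Submodule k ↥(TP k V p)) (T : Submodule k ↥(TP k V q)) :
    Submodule k ↥(TP k V (p + q)) :=
  Submodule.map (concatEquiv k V p q).toLinearMap
    (LinearMap.range (TensorProduct.map S.subtype T.subtype))

variable (R : Submodule k ↥(TP k V 2))

/-- The subspace `V^{⊗i} ⊗ R ⊗ V^{⊗j}` of `V^{⊗(i+2+j)}`. -/
def relTerm (i j : ℕ) : Submodule k ↥(TP k V (i + 2 + j)) :=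
  castTP k V (by omega)
    (concatSub k V (⊤ : Submodule k ↥(TP k V i)) (concatSub k V R (⊤ : Submodule k ↥(TP k V j))))

/-- The weight-`d` part `Σ_{i=0}^{d−2} V^{⊗i} ⊗ R ⊗ V^{⊗(d−2−i)}` of the ideal generated by `R`,
so that the weight-`d` piece of the quadratic algebra `A = T(V)/(R)` is `A_d = V^{⊗d}/RelOf d`. -/
def RelOf (d : ℕ) : Submodule k ↥(TP k V d) :=
  ⨆ i : Fin (d - 1), castTP k V (by have := i.isLt; omega) (relTerm k V R i (d - 2 - i))

/-- The weight-`d` component of the Koszul dual of `A = T(V)/(R)`: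
`A^¡_0 = k`, `A^¡_1 = V` and `A^¡_d = ⋂_{i=0}^{d−2} V^{⊗i} ⊗ R ⊗ V^{⊗(d−2−i)}` for `d ≥ 2`. -/
def Dual (d : ℕ) : Submodule k ↥(TP k V d) :=
  ⨅ i : Fin (d - 1), castTP k V (by have := i.isLt; omega) (relTerm k V R i (d - 2 - i))

/-- The numerator `A^¡_d ⊗ V^{⊗(ρ−d)}` of the `d`-th term of the Koszul complex of weight `ρ`
(the `d`-th term of the Koszul complex is `A^¡_d ⊗ A_{ρ−d} = Kt ρ d / Kr ρ d`, with all terms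
realized as subquotients of `V^{⊗ρ}` along the canonical identifications; the differentials are
then all induced by the identity of `V^{⊗ρ}`). -/
def Kt (ρ d : ℕ) : Submodule k ↥(TP k V ρ) :=
  if h : d ≤ ρ then
    castTP k V (by omega) (concatSub k V (Dual k V R d) (⊤ : Submodule k ↥(TP k V (ρ - d))))
  else ⊥

/-- The denominator `A^¡_d ⊗ (RelOf (ρ−d))` of the `d`-th term of the Koszul complex of weight
`ρ`, so that this term is `A^¡_d ⊗ A_{ρ−d} = Kt ρ d / Kr ρ d`. -/
def Kr (ρ d : ℕ) : Submodule k ↥(TP k V ρ) :=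
  if h : d ≤ ρ then
    castTP k V (by omega) (concatSub k V (Dual k V R d) (RelOf k V R (ρ - d)))
  else ⊥

/-- `A = T(V)/(R)` is Koszul: for every weight `ρ ≥ 1` the Koszul complex
`0 → A^¡_ρ → A^¡_{ρ−1} ⊗ A_1 → ⋯ → A^¡_1 ⊗ A_{ρ−1} → A_ρ → 0`
is exact.  Realizing the `d`-th term as the subquotient `Kt ρ d / Kr ρ d` of `V^{⊗ρ}` (with the
differentials induced by the identity of `V^{⊗ρ}`), exactness at the `d`-th term reads
`Kt ρ d ⊓ Kr ρ (d−1) = Kr ρ d ⊔ Kt ρ (d+1)` (at `d = 0` the kernel of the outgoing map is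
everything, whence the `if`). -/
def IsKoszul : Prop :=
  ∀ ρ ≥ 1, ∀ d ≤ ρ,
    Kt k V R ρ d ⊓ (if d = 0 then ⊤ else Kr k V R ρ (d - 1)) =
      Kr k V R ρ d ⊔ Kt k V R ρ (d + 1)

variable (W : Type) [AddCommGroup W] [Module k W]

/-- Functoriality of tensor powers: a linear map `f : M → N` induces `f^{⊗n} : M^{⊗n} → N^{⊗n}`. -/
def TPmap {M N : Type} [AddCommGroup M] [Module k M] [AddCommGroup N] [Module k N]
    (f : M →ₗ[k] N) : ∀ n : ℕ, ↥(TP k M n) →ₗ[k] ↥(TP k N n)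
  | 0 => LinearMap.id
  | 1 => f
  | (n + 2) => TensorProduct.map (TPmap f (n + 1)) f

/-- The canonical identification `M ⊗ M ≅ TP k M 2`. -/
def toTP2 (M : Type) [AddCommGroup M] [Module k M] : (M ⊗[k] M) ≃ₗ[k] ↥(TP k M 2) :=
  concatEquiv k M 1 1

/-- The image of `R ⊆ V ⊗ V` in `(V ⊕ W)^{⊗2}`. -/
def embRR (R : Submodule k (V ⊗[k] V)) : Submodule k ↥(TP k (V × W) 2) :=
  Submodule.map ((toTP2 k (V × W)).toLinearMap ∘ₗ
    TensorProduct.map (LinearMap.inl k V W) (LinearMap.inl k V W)) R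

/-- The image of `S ⊆ W ⊗ W` in `(V ⊕ W)^{⊗2}`. -/
def embSS (S : Submodule k (W ⊗[k] W)) : Submodule k ↥(TP k (V × W) 2) :=
  Submodule.map ((toTP2 k (V × W)).toLinearMap ∘ₗ
    TensorProduct.map (LinearMap.inr k V W) (LinearMap.inr k V W)) S

/-- The graph `D_λ = { x − λ(x) : x ∈ W ⊗ V } ⊆ (V ⊕ W)^{⊗2}` of a linear map
`λ : W ⊗ V → V ⊗ W`. -/
def embD (lam : (W ⊗[k] V) →ₗ[k] (V ⊗[k] W)) : Submodule k ↥(TP k (V × W) 2) :=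
  LinearMap.range
    (((toTP2 k (V × W)).toLinearMap ∘ₗ
        TensorProduct.map (LinearMap.inr k V W) (LinearMap.inl k V W) :
        (W ⊗[k] V) →ₗ[k] ↥(TP k (V × W) 2))
      - ((toTP2 k (V × W)).toLinearMap ∘ₗ
          TensorProduct.map (LinearMap.inl k V W) (LinearMap.inr k V W)) ∘ₗ lam)

/-- The quadratic relations `R ⊕ D_λ ⊕ S ⊆ (V ⊕ W)^{⊗2}` of `P = T(V⊕W)/(R ⊕ D_λ ⊕ S)`. -/
def relP (R : Submodule k (V ⊗[k] V)) (S : Submodule k (W ⊗[k] W))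
    (lam : (W ⊗[k] V) →ₗ[k] (V ⊗[k] W)) : Submodule k ↥(TP k (V × W) 2) :=
  embRR k V W R ⊔ embD k V W lam ⊔ embSS k V W S

variable (R : Submodule k (V ⊗[k] V)) (S : Submodule k (W ⊗[k] W))
variable (lam : (W ⊗[k] V) →ₗ[k] (V ⊗[k] W))

/-- The map `A_a ⊗ B_b → P_{a+b}` induced by multiplication in `P` (on representatives: the word
`v₁⋯v_a ⊗ w₁⋯w_b` of `V^{⊗a} ⊗ W^{⊗b}` is sent to the class of its concatenation in
`P_{a+b} = (V⊕W)^{⊗(a+b)}/RelOf (a+b)`). -/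
def multVW (a b : ℕ) :
    (↥(TP k V a) ⊗[k] ↥(TP k W b)) →ₗ[k]
      (↥(TP k (V × W) (a + b)) ⧸ RelOf k (V × W) (relP k V W R S lam) (a + b)) :=
  (RelOf k (V × W) (relP k V W R S lam) (a + b)).mkQ ∘ₗ
    (concatEquiv k (V × W) a b).toLinearMap ∘ₗ
    TensorProduct.map (TPmap k (LinearMap.inl k V W) a) (TPmap k (LinearMap.inr k V W) b)

/-- The canonical kernel of the map `V^{⊗a} ⊗ W^{⊗b} → A_a ⊗ B_b`, namely
`(Rel_A a) ⊗ W^{⊗b} + V^{⊗a} ⊗ (Rel_B b)`; the multiplication map `A_a ⊗ B_b → P_{a+b}` is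
injective precisely when the kernel of `multVW a b` equals it. -/
def denVW (a b : ℕ) : Submodule k (↥(TP k V a) ⊗[k] ↥(TP k W b)) :=
  LinearMap.range (LinearMap.rTensor ↥(TP k W b)
      (RelOf k V (Submodule.map (toTP2 k V).toLinearMap R) a).subtype) ⊔
    LinearMap.range (LinearMap.lTensor ↥(TP k V a)
      (RelOf k W (Submodule.map (toTP2 k W).toLinearMap S) b).subtype)

/-- `λ` is a replacement rule: the two maps `A_1 ⊗ B_2 → P_3` and `A_2 ⊗ B_1 → P_3` induced by
multiplication in `P` are injective. -/
def IsReplacementRule : Prop :=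
  LinearMap.ker (multVW k V W R S lam 1 2) = denVW k V W R S 1 2 ∧
  LinearMap.ker (multVW k V W R S lam 2 1) = denVW k V W R S 2 1

/-- Transport of the weight components of `P` along an equality of weights. -/
def castP {m n : ℕ} (h : m = n) :
    (↥(TP k (V × W) m) ⧸ RelOf k (V × W) (relP k V W R S lam) m) →ₗ[k]
      (↥(TP k (V × W) n) ⧸ RelOf k (V × W) (relP k V W R S lam) n) :=
  h ▸ LinearMap.id

/-- The total multiplication map `⊕_{a+b=d} (V^{⊗a} ⊗ W^{⊗b}) → P_d` (on each summand it is the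
map induced by multiplication in `P` via the canonical algebra maps `A → P` and `B → P`). -/
def multTotal (d : ℕ) :
    (DirectSum {ab : ℕ × ℕ // ab.1 + ab.2 = d}
        fun ab => ↥(TP k V ab.1.1) ⊗[k] ↥(TP k W ab.1.2)) →ₗ[k]
      (↥(TP k (V × W) d) ⧸ RelOf k (V × W) (relP k V W R S lam) d) :=
  DirectSum.toModule k _ _
    fun ab => castP k V W R S lam ab.2 ∘ₗ multVW k V W R S lam ab.1.1 ab.1.2

section Products

variable {k}
variable {X Y Z E : Type*} [AddCommGroup X] [Module k X] [AddCommGroup Y] [Module k Y]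
  [AddCommGroup Z] [Module k Z] [Ring E] [Algebra k E]

/-- The linear map `x ⊗ y ↦ f x * g y`. -/
def mulMap (f : X →ₗ[k] E) (g : Y →ₗ[k] E) : (X ⊗[k] Y) →ₗ[k] E :=
  LinearMap.mul' k E ∘ₗ TensorProduct.map f g

@[simp] lemma mulMap_tmul (f : X →ₗ[k] E) (g : Y →ₗ[k] E) (x : X) (y : Y) :
    mulMap f g (x ⊗ₜ y) = f x * g y := by
  simp [mulMap]

lemma mulMap_assoc (f : X →ₗ[k] E) (g : Y →ₗ[k] E) (h : Z →ₗ[k] E) (t : (X ⊗[k] Y) ⊗[k] Z) :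
    mulMap f (mulMap g h) (TensorProduct.assoc k X Y Z t) = mulMap (mulMap f g) h t := by
  suffices mulMap f (mulMap g h) ∘ₗ (TensorProduct.assoc k X Y Z).toLinearMap =
      mulMap (mulMap f g) h from LinearMap.congr_fun this t
  ext x y z
  simp [mul_assoc]

lemma mulMap_assoc_symm (f : X →ₗ[k] E) (g : Y →ₗ[k] E) (h : Z →ₗ[k] E)
    (t : X ⊗[k] (Y ⊗[k] Z)) :
    mulMap (mulMap f g) h ((TensorProduct.assoc k X Y Z).symm t) = mulMap f (mulMap g h) t := by
  rw [← mulMap_assoc, LinearEquiv.apply_symm_apply]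

/-- A subspace of an algebra that is stable under multiplication on both sides. -/
structure IsTwoSidedSubspace (I : Submodule k E) : Prop where
  mul_left : ∀ a : E, ∀ x ∈ I, a * x ∈ I
  mul_right : ∀ a : E, ∀ x ∈ I, x * a ∈ I

lemma isTwoSidedSubspace_bot : IsTwoSidedSubspace (⊥ : Submodule k E) where
  mul_left a x hx := by simp_all
  mul_right a x hx := by simp_all

lemma isTwoSidedSubspace_top_mul_mul_top (I : Submodule k E) :
    IsTwoSidedSubspace (⊤ * I * ⊤) where
  mul_left a x hx := by
    have h : (⊤ : Submodule k E) * (⊤ * I * ⊤) ≤ ⊤ * I * ⊤ := by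
      rw [← mul_assoc, ← mul_assoc]
      exact mul_le_mul_left (mul_le_mul_left le_top _) _
    exact h (Submodule.mul_mem_mul trivial hx)
  mul_right a x hx := by
    have h : (⊤ * I * ⊤ : Submodule k E) * ⊤ ≤ ⊤ * I * ⊤ := by
      rw [mul_assoc]
      exact mul_le_mul_right le_top _
    exact h (Submodule.mul_mem_mul hx trivial)

lemma le_top_mul_mul_top (I : Submodule k E) : I ≤ ⊤ * I * ⊤ := fun x hx => by
  simpa using Submodule.mul_mem_mul
    (Submodule.mul_mem_mul (Submodule.mem_top (x := (1 : E))) hx) (Submodule.mem_top (x := (1 : E)))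

lemma mulMap_mem_of_mem_range_lTensor {I : Submodule k E} (hI : IsTwoSidedSubspace I)
    {U : Submodule k Y} {f : X →ₗ[k] E} {g : Y →ₗ[k] E} (hU : ∀ y ∈ U, g y ∈ I)
    {t : X ⊗[k] Y} (ht : t ∈ LinearMap.range (LinearMap.lTensor X U.subtype)) :
    mulMap f g t ∈ I := by
  obtain ⟨t, rfl⟩ := ht
  induction t with
  | zero => simp
  | add a b ha hb => simpa only [map_add] using add_mem ha hb
  | tmul x y => simpa using hI.mul_left _ _ (hU _ y.2)

lemma mulMap_mem_of_mem_range_rTensor {I : Submodule k E} (hI : IsTwoSidedSubspace I)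
    {U : Submodule k X} {f : X →ₗ[k] E} {g : Y →ₗ[k] E} (hU : ∀ x ∈ U, f x ∈ I)
    {t : X ⊗[k] Y} (ht : t ∈ LinearMap.range (LinearMap.rTensor Y U.subtype)) :
    mulMap f g t ∈ I := by
  obtain ⟨t, rfl⟩ := ht
  induction t with
  | zero => simp
  | add a b ha hb => simpa only [map_add] using add_mem ha hb
  | tmul x y => simpa using hI.mul_right _ _ (hU _ x.2)

lemma mulMap_rTensor_sub_mem {X' : Type*} [AddCommGroup X'] [Module k X']
    {I : Submodule k E} (hI : IsTwoSidedSubspace I)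
    {f : X →ₗ[k] E} {f' : X' →ₗ[k] E} (g : Y →ₗ[k] E) {l : X →ₗ[k] X'}
    (hl : ∀ x, f x - f' (l x) ∈ I) (t : X ⊗[k] Y) :
    mulMap f g t - mulMap f' g (LinearMap.rTensor Y l t) ∈ I := by
  induction t with
  | zero => simp
  | add a b ha hb =>
    simp only [map_add]
    rw [add_sub_add_comm]
    exact add_mem ha hb
  | tmul x y => simpa [sub_mul] using hI.mul_right (g y) _ (hl x)

lemma mulMap_lTensor_sub_mem {Y' : Type*} [AddCommGroup Y'] [Module k Y']
    {I : Submodule k E} (hI : IsTwoSidedSubspace I)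
    (f : X →ₗ[k] E) {g : Y →ₗ[k] E} {g' : Y' →ₗ[k] E} {l : Y →ₗ[k] Y'}
    (hl : ∀ y, g y - g' (l y) ∈ I) (t : X ⊗[k] Y) :
    mulMap f g t - mulMap f g' (LinearMap.lTensor X l t) ∈ I := by
  induction t with
  | zero => simp
  | add a b ha hb =>
    simp only [map_add]
    rw [add_sub_add_comm]
    exact add_mem ha hb
  | tmul x y => simpa [mul_sub] using hI.mul_left (f x) _ (hl y)

end Products

section Replacement

variable {k V W}

/-- The map `W ⊗ V ⊗ V → V ⊗ V ⊗ W` obtained by applying `λ` twice. -/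
def moveVV : (W ⊗[k] (V ⊗[k] V)) →ₗ[k] ((V ⊗[k] V) ⊗[k] W) :=
  (TensorProduct.assoc k V V W).symm.toLinearMap ∘ₗ LinearMap.lTensor V lam ∘ₗ
    (TensorProduct.assoc k V W V).toLinearMap ∘ₗ LinearMap.rTensor V lam ∘ₗ
    (TensorProduct.assoc k W V V).symm.toLinearMap

/-- The map `W ⊗ W ⊗ V → V ⊗ W ⊗ W` obtained by applying `λ` twice. -/
def moveWW : ((W ⊗[k] W) ⊗[k] V) →ₗ[k] (V ⊗[k] (W ⊗[k] W)) :=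
  (TensorProduct.assoc k V W W).toLinearMap ∘ₗ LinearMap.rTensor W lam ∘ₗ
    (TensorProduct.assoc k W V W).symm.toLinearMap ∘ₗ LinearMap.lTensor W lam ∘ₗ
    (TensorProduct.assoc k W W V).toLinearMap

variable {lam}
variable {E : Type*} [Ring E] [Algebra k E] {I : Submodule k E} {f : V →ₗ[k] E} {g : W →ₗ[k] E}

lemma mulMap_moveVV_sub_mem (hI : IsTwoSidedSubspace I)
    (hD : ∀ t, mulMap g f t - mulMap f g (lam t) ∈ I) (t : W ⊗[k] (V ⊗[k] V)) :
    mulMap g (mulMap f f) t - mulMap (mulMap f f) g (moveVV lam t) ∈ I := by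
  have h₁ := mulMap_rTensor_sub_mem hI f hD ((TensorProduct.assoc k W V V).symm t)
  have h₂ := mulMap_lTensor_sub_mem hI f hD (TensorProduct.assoc k V W V
    (LinearMap.rTensor V lam ((TensorProduct.assoc k W V V).symm t)))
  rw [mulMap_assoc_symm] at h₁
  rw [mulMap_assoc, ← mulMap_assoc_symm] at h₂
  simpa [moveVV] using add_mem h₁ h₂

lemma mulMap_moveWW_sub_mem (hI : IsTwoSidedSubspace I)
    (hD : ∀ t, mulMap g f t - mulMap f g (lam t) ∈ I) (t : (W ⊗[k] W) ⊗[k] V) :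
    mulMap (mulMap g g) f t - mulMap f (mulMap g g) (moveWW lam t) ∈ I := by
  have h₁ := mulMap_lTensor_sub_mem hI g hD (TensorProduct.assoc k W W V t)
  have h₂ := mulMap_rTensor_sub_mem hI g hD ((TensorProduct.assoc k W V W).symm
    (LinearMap.lTensor W lam (TensorProduct.assoc k W W V t)))
  rw [mulMap_assoc] at h₁
  rw [mulMap_assoc_symm, ← mulMap_assoc] at h₂
  simpa [moveWW] using add_mem h₁ h₂

end Replacement

section Words

variable {k}
variable {M N : Type} [AddCommGroup M] [Module k M] [AddCommGroup N] [Module k N]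

/-- The embedding of `M^{⊗n}` in the tensor algebra. -/
def toTA : ∀ n : ℕ, ↥(TP k M n) →ₗ[k] TensorAlgebra k M
  | 0 => Algebra.linearMap k (TensorAlgebra k M)
  | 1 => TensorAlgebra.ι k (M := M)
  | (n + 2) => mulMap (toTA (n + 1)) (TensorAlgebra.ι k (M := M))

lemma toTA_stepEquiv (n : ℕ) (x : ↥(TP k M n)) (v : M) :
    toTA (n + 1) (stepEquiv k M n (x ⊗ₜ v)) = toTA n x * TensorAlgebra.ι k v := by
  cases n with
  | zero =>
    change k at x
    change TensorAlgebra.ι k (TensorProduct.lid k M (x ⊗ₜ v)) =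
      algebraMap k (TensorAlgebra k M) x * _
    rw [TensorProduct.lid_tmul, map_smul, Algebra.smul_def]
  | succ n => exact mulMap_tmul _ _ _ _

/-- Every element of `M^{⊗(n+1)}` is a sum of products. -/
lemma TP_succ_induction {n : ℕ} {motive : ↥(TP k M (n + 1)) → Prop} (zero : motive 0)
    (add : ∀ x y, motive x → motive y → motive (x + y))
    (step : ∀ x v, motive (stepEquiv k M n (x ⊗ₜ v))) (x : ↥(TP k M (n + 1))) : motive x := by
  obtain ⟨t, rfl⟩ := (stepEquiv k M n).surjective x
  induction t with
  | zero => simpa using zero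
  | add a b ha hb => simpa using add _ _ ha hb
  | tmul x v => exact step x v

lemma toTA_concatEquiv (p q : ℕ) (x : ↥(TP k M p)) (y : ↥(TP k M q)) :
    toTA (p + q) (concatEquiv k M p q (x ⊗ₜ y)) = toTA p x * toTA q y := by
  induction q using Nat.strong_induction_on with
  | _ q ih =>
  match q, y, ih with
  | 0, y, _ =>
    change k at y
    change toTA p (TensorProduct.rid k ↥(TP k M p) (x ⊗ₜ y)) =
      _ * algebraMap k (TensorAlgebra k M) y
    rw [TensorProduct.rid_tmul, map_smul, Algebra.smul_def, Algebra.commutes]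
  | 1, y, _ => exact toTA_stepEquiv p x y
  | q + 2, y, ih =>
    induction y using TP_succ_induction with
    | zero => simp
    | add a b ha hb => simp only [TensorProduct.tmul_add, map_add, mul_add, ha, hb]
    | step y v =>
      change toTA (p + (q + 1) + 1) (stepEquiv k M (p + (q + 1))
        (concatEquiv k M p (q + 1) (x ⊗ₜ y) ⊗ₜ v)) = _
      rw [toTA_stepEquiv, ih (q + 1) (by omega), mul_assoc, toTA_stepEquiv]

/-- Appending a letter on the right, on the direct sum of all tensor powers. -/
def appendLetter : M →ₗ[k] Module.End k (DirectSum ℕ fun n => ↥(TP k M n)) :=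
  LinearMap.flip (DirectSum.toModule k ℕ _ fun n =>
    (LinearMap.compr₂ (TensorProduct.mk k ↥(TP k M n) M)
      (DirectSum.lof k ℕ (fun n => ↥(TP k M n)) (n + 1) ∘ₗ (stepEquiv k M n).toLinearMap)))

/-- The empty word. -/
def emptyWord : ↥(TP k M 0) := (1 : k)

/-- The decomposition of a tensor into its homogeneous components. -/
def fromTA : TensorAlgebra k M →ₗ[k] DirectSum ℕ fun n => ↥(TP k M n) :=
  LinearMap.applyₗ (DirectSum.lof k ℕ (fun n => ↥(TP k M n)) 0 emptyWord) ∘ₗ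
    (MulOpposite.opLinearEquiv k).symm.toLinearMap ∘ₗ
    (TensorAlgebra.lift k ((MulOpposite.opLinearEquiv k).toLinearMap ∘ₗ
      appendLetter (k := k) (M := M))).toLinearMap

lemma fromTA_mul_ι (z : TensorAlgebra k M) (v : M) :
    fromTA (z * TensorAlgebra.ι k v) = appendLetter v (fromTA z) := by
  simp [fromTA]

lemma fromTA_toTA (n : ℕ) (x : ↥(TP k M n)) :
    fromTA (toTA n x) = DirectSum.lof k ℕ (fun n => ↥(TP k M n)) n x := by
  induction n with
  | zero =>
    change k at x
    change fromTA (algebraMap k (TensorAlgebra k M) x) = _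
    rw [Algebra.algebraMap_eq_smul_one, map_smul]
    have h : fromTA (1 : TensorAlgebra k M) =
        DirectSum.lof k ℕ (fun n => ↥(TP k M n)) 0 emptyWord := by
      simp [fromTA]
    have hx : x • (emptyWord : ↥(TP k M 0)) = x := mul_one x
    rw [h, ← map_smul, hx]
  | succ n ih =>
    induction x using TP_succ_induction with
    | zero => simp
    | add a b ha hb => simp only [map_add, ha, hb]
    | step y v =>
      rw [toTA_stepEquiv, fromTA_mul_ι, ih]
      simp [appendLetter]

/-- The component of degree `n` of a tensor. -/
def projTA (n : ℕ) : TensorAlgebra k M →ₗ[k] ↥(TP k M n) :=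
  DirectSum.component k ℕ (fun n => ↥(TP k M n)) n ∘ₗ fromTA

lemma projTA_toTA (n : ℕ) (x : ↥(TP k M n)) : projTA n (toTA n x) = x := by
  simp [projTA, fromTA_toTA, DirectSum.component.lof_self]

lemma projTA_toTA_of_ne {m n : ℕ} (h : n ≠ m) (x : ↥(TP k M n)) :
    projTA m (toTA n x) = 0 := by
  simp only [projTA, LinearMap.comp_apply, fromTA_toTA, DirectSum.component.of, dif_neg h]

lemma toTA_injective (n : ℕ) : Function.Injective (toTA (k := k) (M := M) n) :=
  Function.LeftInverse.injective (projTA_toTA n)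

lemma one_mem_range_toTA : (1 : TensorAlgebra k M) ∈ LinearMap.range (toTA (k := k) (M := M) 0) :=
  ⟨(1 : k), map_one (algebraMap k (TensorAlgebra k M))⟩

lemma range_toTA_zero : LinearMap.range (toTA (k := k) (M := M) 0) = 1 :=
  Submodule.one_eq_range.symm

lemma iSup_range_toTA : ⨆ n, LinearMap.range (toTA (k := k) (M := M) n) = ⊤ := by
  rw [eq_top_iff]
  rintro z -
  suffices h : ∀ y ∈ ⨆ n, LinearMap.range (toTA (k := k) (M := M) n),
      y * z ∈ ⨆ n, LinearMap.range (toTA (k := k) (M := M) n) by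
    simpa using h 1 (Submodule.mem_iSup_of_mem 0 one_mem_range_toTA)
  induction z using TensorAlgebra.induction with
  | algebraMap r =>
    intro y hy
    rw [← Algebra.commutes, ← Algebra.smul_def]
    exact Submodule.smul_mem _ _ hy
  | ι v =>
    intro y hy
    induction hy using Submodule.iSup_induction' with
    | mem n x hx =>
      obtain ⟨x, rfl⟩ := hx
      exact Submodule.mem_iSup_of_mem (n + 1) ⟨_, toTA_stepEquiv n x v⟩
    | zero => simp
    | add a b _ _ ha hb => simpa only [add_mul] using add_mem ha hb
  | mul a b ha hb =>
    intro y hy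
    rw [← mul_assoc]
    exact hb _ (ha _ hy)
  | add a b ha hb =>
    intro y hy
    rw [mul_add]
    exact add_mem (ha _ hy) (hb _ hy)

lemma TPmap_stepEquiv (f : M →ₗ[k] N) (n : ℕ) (x : ↥(TP k M n)) (v : M) :
    TPmap k f (n + 1) (stepEquiv k M n (x ⊗ₜ v)) = stepEquiv k N n (TPmap k f n x ⊗ₜ f v) := by
  cases n with
  | zero => exact map_smul f (show k from x) v
  | succ n => rfl

/-- The algebra map between tensor algebras induced by a linear map. -/
def mapTA (f : M →ₗ[k] N) : TensorAlgebra k M →ₐ[k] TensorAlgebra k N :=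
  TensorAlgebra.lift k (TensorAlgebra.ι k ∘ₗ f)

@[simp] lemma mapTA_ι (f : M →ₗ[k] N) (v : M) :
    mapTA f (TensorAlgebra.ι k v) = TensorAlgebra.ι k (f v) := by
  simp [mapTA]

lemma toTA_TPmap (f : M →ₗ[k] N) (n : ℕ) (x : ↥(TP k M n)) :
    toTA n (TPmap k f n x) = mapTA f (toTA n x) := by
  induction n with
  | zero => exact ((mapTA f).commutes (show k from x)).symm
  | succ n ih =>
    induction x using TP_succ_induction with
    | zero => simp
    | add a b ha hb => simp only [map_add, ha, hb]
    | step y v => simp [TPmap_stepEquiv, toTA_stepEquiv, ih]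

/-- Transport of tensors along an equality of degrees. -/
def castWord {m n : ℕ} (h : m = n) : ↥(TP k M m) →ₗ[k] ↥(TP k M n) :=
  h ▸ LinearMap.id

lemma toTA_castWord {m n : ℕ} (h : m = n) (x : ↥(TP k M m)) :
    toTA n (castWord h x) = toTA m x := by
  subst h
  rfl

lemma map_toTA_castTP {m n : ℕ} (h : m = n) (U : Submodule k ↥(TP k M m)) :
    Submodule.map (toTA n) (castTP k M h U) = Submodule.map (toTA m) U := by
  subst h
  rfl

lemma map_toTA_concatSub {p q : ℕ} (U : Submodule k ↥(TP k M p)) (T : Submodule k ↥(TP k M q)) :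
    Submodule.map (toTA (p + q)) (concatSub k M U T) =
      Submodule.map (toTA p) U * Submodule.map (toTA q) T := by
  apply le_antisymm
  · rintro _ ⟨_, ⟨_, ⟨t, rfl⟩, rfl⟩, rfl⟩
    induction t with
    | zero => simp
    | add a b ha hb => simpa only [map_add] using add_mem ha hb
    | tmul x y =>
      refine (toTA_concatEquiv p q (x : ↥(TP k M p)) (y : ↥(TP k M q))).symm ▸ ?_
      exact Submodule.mul_mem_mul (Submodule.mem_map_of_mem x.2) (Submodule.mem_map_of_mem y.2)
  · rw [Submodule.mul_le]
    rintro _ ⟨x, hx, rfl⟩ _ ⟨y, hy, rfl⟩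
    exact ⟨_, ⟨_, ⟨⟨x, hx⟩ ⊗ₜ ⟨y, hy⟩, rfl⟩, rfl⟩, toTA_concatEquiv p q x y⟩

lemma map_toTA_relTerm (U : Submodule k ↥(TP k M 2)) (i j : ℕ) :
    Submodule.map (toTA (i + 2 + j)) (relTerm k M U i j) =
      LinearMap.range (toTA i) * Submodule.map (toTA 2) U *
        LinearMap.range (toTA (k := k) (M := M) j) := by
  rw [relTerm, map_toTA_castTP, map_toTA_concatSub, map_toTA_concatSub, Submodule.map_top,
    Submodule.map_top, mul_assoc]

lemma map_toTA_RelOf (U : Submodule k ↥(TP k M 2)) (d : ℕ) :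
    Submodule.map (toTA d) (RelOf k M U d) =
      ⨆ i : Fin (d - 1), LinearMap.range (toTA i) * Submodule.map (toTA 2) U *
        LinearMap.range (toTA (k := k) (M := M) (d - 2 - i)) := by
  simp only [RelOf, Submodule.map_iSup, map_toTA_castTP, map_toTA_relTerm]

/-- The two-sided ideal of the tensor algebra generated by a space of quadratic relations. -/
def relIdeal (U : Submodule k ↥(TP k M 2)) : Submodule k (TensorAlgebra k M) :=
  ⊤ * Submodule.map (toTA 2) U * ⊤

lemma relIdeal_isTwoSided (U : Submodule k ↥(TP k M 2)) : IsTwoSidedSubspace (relIdeal U) :=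
  isTwoSidedSubspace_top_mul_mul_top _

lemma toTA_mem_relIdeal {U : Submodule k ↥(TP k M 2)} {d : ℕ} {x : ↥(TP k M d)}
    (hx : x ∈ RelOf k M U d) : toTA d x ∈ relIdeal U := by
  have h := Submodule.mem_map_of_mem (f := toTA d) hx
  rw [map_toTA_RelOf] at h
  refine (iSup_le fun i => ?_ : _ ≤ relIdeal U) h
  exact mul_le_mul' (mul_le_mul' le_top le_rfl) le_top

lemma projTA_mem_RelOf {U : Submodule k ↥(TP k M 2)} (d : ℕ) {z : TensorAlgebra k M}
    (hz : z ∈ relIdeal U) : projTA d z ∈ RelOf k M U d := by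
  have h : relIdeal U ≤ Submodule.comap (projTA d) (RelOf k M U d) := by
    rw [relIdeal, ← iSup_range_toTA, Submodule.iSup_mul, Submodule.iSup_mul]
    refine iSup_le fun a => ?_
    rw [Submodule.mul_iSup]
    refine iSup_le fun b => ?_
    rw [← map_toTA_relTerm]
    rintro _ ⟨y, hy, rfl⟩
    rw [Submodule.mem_comap]
    by_cases hd : a + 2 + b = d
    · subst hd
      rw [projTA_toTA]
      have hle : Submodule.map (toTA (a + 2 + b)) (relTerm k M U a b) ≤
          Submodule.map (toTA (a + 2 + b)) (RelOf k M U (a + 2 + b)) := by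
        rw [map_toTA_relTerm, map_toTA_RelOf]
        refine le_iSup_of_le ⟨a, by omega⟩ ?_
        rw [show a + 2 + b - 2 - a = b by omega]
      exact (Submodule.map_le_map_iff_of_injective (toTA_injective _) _ _).1 hle hy
    · rw [projTA_toTA_of_ne hd]
      exact zero_mem _
  exact h hz

lemma toTA_mem_relIdeal_iff {U : Submodule k ↥(TP k M 2)} {d : ℕ} {x : ↥(TP k M d)} :
    toTA d x ∈ relIdeal U ↔ x ∈ RelOf k M U d :=
  ⟨fun h => by simpa only [projTA_toTA] using projTA_mem_RelOf d h, toTA_mem_relIdeal⟩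

lemma RelOf_one (U : Submodule k ↥(TP k M 2)) : RelOf k M U 1 = ⊥ := by
  rw [RelOf]
  exact iSup_of_empty (ι := Fin 0) _

lemma RelOf_two_le (U : Submodule k ↥(TP k M 2)) : RelOf k M U 2 ≤ U := by
  refine (Submodule.map_le_map_iff_of_injective (toTA_injective 2) _ _).1 ?_
  rw [map_toTA_RelOf]
  refine iSup_le fun i => ?_
  have hi : (i : ℕ) = 0 := by omega
  rw [hi, range_toTA_zero, one_mul, mul_one]

lemma toTA_toTP2 (t : M ⊗[k] M) :
    toTA 2 (toTP2 k M t) = mulMap (TensorAlgebra.ι k) (TensorAlgebra.ι k) t := by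
  induction t with
  | zero => simp
  | add a b ha hb => simp only [map_add, ha, hb]
  | tmul x y =>
    rw [mulMap_tmul]
    exact toTA_concatEquiv (M := M) 1 1 x y

lemma map_toTA_map_toTP2 (U : Submodule k (M ⊗[k] M)) :
    Submodule.map (toTA 2) (Submodule.map (toTP2 k M).toLinearMap U) =
      Submodule.map (mulMap (TensorAlgebra.ι k) (TensorAlgebra.ι k)) U := by
  rw [← Submodule.map_comp]
  exact congrArg (Submodule.map · U) (LinearMap.ext toTA_toTP2)

end Words

section Action

variable {k V W}

/-- The linear map `x ⊗ y ↦ f x ∘ g y` with values in the endomorphisms of `T(V) ⊗ T(W)`. -/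
abbrev compMap {X Y : Type*} [AddCommGroup X] [Module k X] [AddCommGroup Y] [Module k Y]
    (f : X →ₗ[k] Module.End k (TensorAlgebra k V ⊗[k] TensorAlgebra k W))
    (g : Y →ₗ[k] Module.End k (TensorAlgebra k V ⊗[k] TensorAlgebra k W)) :
    (X ⊗[k] Y) →ₗ[k] Module.End k (TensorAlgebra k V ⊗[k] TensorAlgebra k W) :=
  mulMap (E := Module.End k (TensorAlgebra k V ⊗[k] TensorAlgebra k W)) f g

lemma compMap_tmul {X Y : Type*} [AddCommGroup X] [Module k X] [AddCommGroup Y] [Module k Y]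
    (f : X →ₗ[k] Module.End k (TensorAlgebra k V ⊗[k] TensorAlgebra k W))
    (g : Y →ₗ[k] Module.End k (TensorAlgebra k V ⊗[k] TensorAlgebra k W)) (x : X) (y : Y) :
    compMap f g (x ⊗ₜ y) = f x * g y :=
  mulMap_tmul _ _ _ _

/-- The inclusion of `V` in `T(V) ⊗ T(W)`. -/
def leftLetter : V →ₗ[k] (TensorAlgebra k V ⊗[k] TensorAlgebra k W) :=
  Algebra.TensorProduct.includeLeft.toLinearMap ∘ₗ TensorAlgebra.ι k

/-- The action of `V` on `T(V) ⊗ T(W)` by left multiplication. -/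
def actV : V →ₗ[k] Module.End k (TensorAlgebra k V ⊗[k] TensorAlgebra k W) :=
  (Algebra.lmul k _).toLinearMap ∘ₗ leftLetter

/-- For `g : W → T(V) ⊗ T(W)`, the map `w ↦ ∑ vᵢ * g wᵢ`, where `λ (w ⊗ v) = ∑ vᵢ ⊗ wᵢ`. -/
def moveThrough : V →ₗ[k]
    Module.End k (W →ₗ[k] (TensorAlgebra k V ⊗[k] TensorAlgebra k W)) :=
  LinearMap.mk₂ k (fun v g => mulMap leftLetter g ∘ₗ lam ∘ₗ (TensorProduct.mk k W V).flip v)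
    (fun v v' g => by ext w; simp) (fun c v g => by ext w; simp)
    (fun v g g' => by
      ext w
      simp [mulMap, TensorProduct.map_add_right])
    (fun c v g => by
      ext w
      simp [mulMap, TensorProduct.map_smul_right])

/-- The map `x ⊗ y ↦ (w ↦ w · (x ⊗ y))`, where the letter `w` is moved through `x` by `λ`. -/
def actWHom : (TensorAlgebra k V ⊗[k] TensorAlgebra k W) →ₗ[k]
    (W →ₗ[k] (TensorAlgebra k V ⊗[k] TensorAlgebra k W)) :=
  TensorProduct.lift (LinearMap.lcomp k _
    ((LinearMap.mul k (TensorAlgebra k W) ∘ₗ TensorAlgebra.ι k).flip.compr₂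
      Algebra.TensorProduct.includeRight.toLinearMap) ∘ₗ
    (TensorAlgebra.lift k (moveThrough lam)).toLinearMap)

/-- The action of `W` on `T(V) ⊗ T(W)` determined by `λ`. -/
def actW : W →ₗ[k] Module.End k (TensorAlgebra k V ⊗[k] TensorAlgebra k W) :=
  (actWHom lam).flip

variable {lam}

lemma actV_apply (v : V) (z : TensorAlgebra k V ⊗[k] TensorAlgebra k W) :
    actV v z = (TensorAlgebra.ι k v ⊗ₜ 1) * z := rfl

lemma actW_one_tmul (w : W) (y : TensorAlgebra k W) :
    actW lam w ((1 : TensorAlgebra k V) ⊗ₜ y) = 1 ⊗ₜ (TensorAlgebra.ι k w * y) := by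
  simp [actW, actWHom]

lemma mulMap_actW_actV (t : W ⊗[k] V) :
    compMap (actW lam) actV t = compMap actV (actW lam) (lam t) := by
  induction t with
  | zero => simp
  | add a b ha hb => simp only [map_add, ha, hb]
  | tmul w v =>
    refine TensorProduct.ext' fun x y => ?_
    set g := TensorAlgebra.lift k (moveThrough lam) x
      (((LinearMap.mul k (TensorAlgebra k W) ∘ₗ TensorAlgebra.ι k).flip.compr₂
        Algebra.TensorProduct.includeRight.toLinearMap) y) with hg
    have hgw : ∀ w', actW lam w' (x ⊗ₜ y) = g w' := fun w' => rfl
    have hl : compMap (actW lam) actV (w ⊗ₜ v) (x ⊗ₜ y) =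
        mulMap leftLetter g (lam (w ⊗ₜ v)) := by
      rw [mulMap_tmul, Module.End.mul_apply, actV_apply, Algebra.TensorProduct.tmul_mul_tmul,
        one_mul]
      simp [actW, actWHom, moveThrough, hg]
    rw [hl]
    induction lam (w ⊗ₜ v) with
    | zero => simp
    | add a b ha hb => simp only [map_add, ha, hb, LinearMap.add_apply]
    | tmul v' w' =>
      rw [mulMap_tmul, mulMap_tmul, Module.End.mul_apply, hgw]
      rfl

lemma mulMap_actV_apply (t : V ⊗[k] V) (z : TensorAlgebra k V ⊗[k] TensorAlgebra k W) :
    compMap actV actV t z =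
      (mulMap (TensorAlgebra.ι k) (TensorAlgebra.ι k) t ⊗ₜ 1) * z := by
  induction t with
  | zero => simp
  | add a b ha hb => simp only [map_add, LinearMap.add_apply, ha, hb, TensorProduct.add_tmul,
      add_mul]
  | tmul v v' =>
    simp only [mulMap_tmul, Module.End.mul_apply, actV_apply, ← mul_assoc,
      Algebra.TensorProduct.tmul_mul_tmul, one_mul]

lemma mulMap_actW_one_tmul (t : W ⊗[k] W) (y : TensorAlgebra k W) :
    compMap (actW lam) (actW lam) t ((1 : TensorAlgebra k V) ⊗ₜ y) =
      1 ⊗ₜ (mulMap (TensorAlgebra.ι k) (TensorAlgebra.ι k) t * y) := by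
  induction t with
  | zero => simp
  | add a b ha hb => simp only [map_add, LinearMap.add_apply, ha, hb, TensorProduct.tmul_add,
      add_mul]
  | tmul v v' =>
    simp only [mulMap_tmul, Module.End.mul_apply, actW_one_tmul, mul_assoc]

lemma mulMap_actW_actVV (t : W ⊗[k] (V ⊗[k] V)) :
    compMap (actW lam) (compMap actV actV) t =
      mulMap (compMap actV actV) (actW lam) (moveVV lam t) := by
  have h := mulMap_moveVV_sub_mem (E := Module.End k (TensorAlgebra k V ⊗[k] TensorAlgebra k W))
    (lam := lam) (isTwoSidedSubspace_bot (k := k))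
    (fun t => (Submodule.mem_bot k).2 (sub_eq_zero.2 (mulMap_actW_actV t))) t
  exact sub_eq_zero.1 ((Submodule.mem_bot k).1 h)

lemma mulMap_actWW_actV (t : (W ⊗[k] W) ⊗[k] V) :
    mulMap (compMap (actW lam) (actW lam)) actV t =
      compMap actV (compMap (actW lam) (actW lam)) (moveWW lam t) := by
  have h := mulMap_moveWW_sub_mem (E := Module.End k (TensorAlgebra k V ⊗[k] TensorAlgebra k W))
    (lam := lam) (isTwoSidedSubspace_bot (k := k))
    (fun t => (Submodule.mem_bot k).2 (sub_eq_zero.2 (mulMap_actW_actV t))) t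
  exact sub_eq_zero.1 ((Submodule.mem_bot k).1 h)

/-- A subspace of `T(V) ⊗ T(W)` stable under the letters of `V` is stable under `T(V)`. -/
lemma tmul_one_mul_mem {Q : Submodule k (TensorAlgebra k V ⊗[k] TensorAlgebra k W)}
    (hQ : ∀ v, ∀ z ∈ Q, actV v z ∈ Q) (x : TensorAlgebra k V) :
    ∀ z ∈ Q, (x ⊗ₜ 1) * z ∈ Q := by
  induction x using TensorAlgebra.induction with
  | algebraMap r =>
    intro z hz
    rw [Algebra.algebraMap_eq_smul_one, ← TensorProduct.smul_tmul', smul_mul_assoc,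
      ← Algebra.TensorProduct.one_def, one_mul]
    exact Q.smul_mem r hz
  | ι v => exact hQ v
  | mul a b ha hb =>
    intro z hz
    have h : (a * b) ⊗ₜ[k] (1 : TensorAlgebra k W) = (a ⊗ₜ 1) * (b ⊗ₜ 1) := by simp
    rw [h, mul_assoc]
    exact ha _ (hb _ hz)
  | add a b ha hb =>
    intro z hz
    rw [TensorProduct.add_tmul, add_mul]
    exact add_mem (ha z hz) (hb z hz)

lemma tmul_eq_mul (x : TensorAlgebra k V) (y : TensorAlgebra k W) :
    x ⊗ₜ[k] y = (x ⊗ₜ 1) * (1 ⊗ₜ y) := by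
  simp

/-- A subspace of `T(V) ⊗ T(W)` stable under the letters of `V` and containing `1 ⊗ T(W)` is
everything. -/
lemma mem_of_stable {Q : Submodule k (TensorAlgebra k V ⊗[k] TensorAlgebra k W)}
    (hQ : ∀ v, ∀ z ∈ Q, actV v z ∈ Q) (h₁ : ∀ y, (1 : TensorAlgebra k V) ⊗ₜ y ∈ Q)
    (z : TensorAlgebra k V ⊗[k] TensorAlgebra k W) : z ∈ Q := by
  induction z with
  | zero => exact zero_mem _
  | add a b ha hb => exact add_mem ha hb
  | tmul x y =>
    rw [tmul_eq_mul]
    exact tmul_one_mul_mem hQ x _ (h₁ y)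

variable (lam) in
/-- The action of `T(V ⊕ W)` on `T(V) ⊗ T(W)`. -/
def act : TensorAlgebra k (V × W) →ₐ[k]
    Module.End k (TensorAlgebra k V ⊗[k] TensorAlgebra k W) :=
  TensorAlgebra.lift k (actV ∘ₗ LinearMap.fst k V W + actW lam ∘ₗ LinearMap.snd k V W)

variable (k V W) in
/-- The letters of `T(V ⊕ W)` coming from `V`. -/
def letterV : V →ₗ[k] TensorAlgebra k (V × W) := TensorAlgebra.ι k ∘ₗ LinearMap.inl k V W

variable (k V W) in
/-- The letters of `T(V ⊕ W)` coming from `W`. -/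
def letterW : W →ₗ[k] TensorAlgebra k (V × W) := TensorAlgebra.ι k ∘ₗ LinearMap.inr k V W

lemma ι_eq_letterV_add_letterW (u : V × W) :
    TensorAlgebra.ι k u = letterV k V W u.1 + letterW k V W u.2 := by
  rw [letterV, letterW, LinearMap.comp_apply, LinearMap.comp_apply, ← map_add]
  simp

@[simp] lemma act_letterV (v : V) : act lam (letterV k V W v) = actV v := by
  simp [act, letterV]

@[simp] lemma act_letterW (w : W) : act lam (letterW k V W w) = actW lam w := by
  simp [act, letterW]

lemma act_mulMap {X Y : Type*} [AddCommGroup X] [Module k X] [AddCommGroup Y] [Module k Y]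
    {f : X →ₗ[k] TensorAlgebra k (V × W)} {g : Y →ₗ[k] TensorAlgebra k (V × W)}
    {f' : X →ₗ[k] Module.End k (TensorAlgebra k V ⊗[k] TensorAlgebra k W)}
    {g' : Y →ₗ[k] Module.End k (TensorAlgebra k V ⊗[k] TensorAlgebra k W)}
    (hf : ∀ x, act lam (f x) = f' x) (hg : ∀ y, act lam (g y) = g' y) (t : X ⊗[k] Y) :
    act lam (mulMap f g t) = compMap f' g' t := by
  induction t with
  | zero => simp
  | add a b ha hb => simp only [map_add, ha, hb]
  | tmul x y => simp [hf, hg]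

variable (k V W) in
/-- The multiplication map `T(V) ⊗ T(W) → T(V ⊕ W)`. -/
def mulVW : (TensorAlgebra k V ⊗[k] TensorAlgebra k W) →ₗ[k] TensorAlgebra k (V × W) :=
  mulMap (mapTA (LinearMap.inl k V W)).toLinearMap (mapTA (LinearMap.inr k V W)).toLinearMap

lemma mulVW_tmul (x : TensorAlgebra k V) (y : TensorAlgebra k W) :
    mulVW k V W (x ⊗ₜ y) = mapTA (LinearMap.inl k V W) x * mapTA (LinearMap.inr k V W) y :=
  mulMap_tmul _ _ _ _

lemma mulVW_actV (v : V) (z : TensorAlgebra k V ⊗[k] TensorAlgebra k W) :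
    mulVW k V W (actV v z) = letterV k V W v * mulVW k V W z := by
  induction z with
  | zero => simp
  | add a b ha hb => simp only [map_add, ha, hb, mul_add]
  | tmul x y =>
    rw [actV_apply, Algebra.TensorProduct.tmul_mul_tmul, one_mul, mulVW_tmul, mulVW_tmul, map_mul,
      mapTA_ι, mul_assoc]
    rfl

lemma act_mapTA_inr (y b : TensorAlgebra k W) :
    act lam (mapTA (LinearMap.inr k V W) y) (1 ⊗ₜ b) = 1 ⊗ₜ (y * b) := by
  induction y using TensorAlgebra.induction generalizing b with
  | algebraMap r =>
    rw [AlgHom.commutes, AlgHom.commutes, Module.algebraMap_end_apply, ← Algebra.smul_def,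
      TensorProduct.tmul_smul]
  | ι w =>
    rw [mapTA_ι]
    change act lam (letterW k V W w) (1 ⊗ₜ b) = _
    rw [act_letterW, actW_one_tmul]
  | mul a c ha hc => rw [map_mul, map_mul, Module.End.mul_apply, hc, ha, mul_assoc]
  | add a c ha hc =>
    rw [map_add, map_add, LinearMap.add_apply, ha, hc, add_mul, TensorProduct.tmul_add]

/-- The action of `T(V ⊕ W)` on `1 ⊗ 1` is a left inverse of the multiplication map. -/
lemma act_mulVW_one (z : TensorAlgebra k V ⊗[k] TensorAlgebra k W) :
    act lam (mulVW k V W z) (1 ⊗ₜ 1) = z := by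
  let Q : Submodule k (TensorAlgebra k V ⊗[k] TensorAlgebra k W) :=
    LinearMap.eqLocus (LinearMap.applyₗ (1 ⊗ₜ 1) ∘ₗ (act lam).toLinearMap ∘ₗ mulVW k V W)
      LinearMap.id
  refine mem_of_stable (Q := Q) (fun v z hz => ?_) (fun y => ?_) z
  · change act lam (mulVW k V W z) (1 ⊗ₜ 1) = z at hz
    change act lam (mulVW k V W (actV v z)) (1 ⊗ₜ 1) = actV v z
    rw [mulVW_actV, map_mul, Module.End.mul_apply, hz, act_letterV]
  · change act lam (mulVW k V W (1 ⊗ₜ y)) (1 ⊗ₜ 1) = 1 ⊗ₜ y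
    rw [mulVW_tmul, map_one, one_mul, act_mapTA_inr, mul_one]

end Action

section Ideals

variable {k V W R S lam}

/-- The relations of `T(V) ⊗ T(W)` defining `A ⊗ B`. -/
def pairIdeal (R : Submodule k (V ⊗[k] V)) (S : Submodule k (W ⊗[k] W)) :
    Submodule k (TensorAlgebra k V ⊗[k] TensorAlgebra k W) :=
  Submodule.map₂ (TensorProduct.mk k _ _)
      (relIdeal (Submodule.map (toTP2 k V).toLinearMap R)) ⊤ ⊔
    Submodule.map₂ (TensorProduct.mk k _ _) ⊤
      (relIdeal (Submodule.map (toTP2 k W).toLinearMap S))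

lemma mulMap_ι_mem_relIdeal {t : V ⊗[k] V} (ht : t ∈ R) :
    mulMap (TensorAlgebra.ι k) (TensorAlgebra.ι k) t ∈
      relIdeal (Submodule.map (toTP2 k V).toLinearMap R) := by
  refine le_top_mul_mul_top _ ?_
  rw [map_toTA_map_toTP2]
  exact Submodule.mem_map_of_mem ht

lemma tmul_mem_pairIdeal_left {x : TensorAlgebra k V}
    (hx : x ∈ relIdeal (Submodule.map (toTP2 k V).toLinearMap R)) (y : TensorAlgebra k W) :
    x ⊗ₜ y ∈ pairIdeal R S :=
  Submodule.mem_sup_left (Submodule.apply_mem_map₂ _ hx trivial)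

lemma tmul_mem_pairIdeal_right (x : TensorAlgebra k V) {y : TensorAlgebra k W}
    (hy : y ∈ relIdeal (Submodule.map (toTP2 k W).toLinearMap S)) :
    x ⊗ₜ y ∈ pairIdeal R S :=
  Submodule.mem_sup_right (Submodule.apply_mem_map₂ _ trivial hy)

lemma actV_mem_pairIdeal (v : V) :
    ∀ z ∈ pairIdeal R S, actV v z ∈ pairIdeal R S := by
  suffices h : pairIdeal R S ≤ Submodule.comap (actV v) (pairIdeal R S) from h
  refine sup_le (Submodule.map₂_le.2 fun x hx y _ => ?_) (Submodule.map₂_le.2 fun x _ y hy => ?_)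
  all_goals
    rw [Submodule.mem_comap, TensorProduct.mk_apply, actV_apply,
      Algebra.TensorProduct.tmul_mul_tmul, one_mul]
  · exact tmul_mem_pairIdeal_left ((relIdeal_isTwoSided _).mul_left _ _ hx) y
  · exact tmul_mem_pairIdeal_right _ hy

lemma compMap_actV_mem_pairIdeal {t : V ⊗[k] V} (ht : t ∈ R)
    (z : TensorAlgebra k V ⊗[k] TensorAlgebra k W) :
    compMap actV actV t z ∈ pairIdeal R S := by
  rw [mulMap_actV_apply]
  induction z with
  | zero => simp
  | add a b ha hb => rw [mul_add]; exact add_mem ha hb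
  | tmul x y =>
    rw [Algebra.TensorProduct.tmul_mul_tmul, one_mul]
    exact tmul_mem_pairIdeal_left
      ((relIdeal_isTwoSided _).mul_right _ _ (mulMap_ι_mem_relIdeal ht)) y

lemma actW_mem_pairIdeal
    (hR : ∀ t ∈ LinearMap.range (LinearMap.lTensor W R.subtype),
      moveVV lam t ∈ LinearMap.range (LinearMap.rTensor W R.subtype)) (w : W) :
    ∀ z ∈ pairIdeal R S, actW lam w z ∈ pairIdeal R S := by
  let Q : Submodule k (TensorAlgebra k V ⊗[k] TensorAlgebra k W) :=
    ⨅ w, Submodule.comap (actW lam w) (pairIdeal R S) ⊓ pairIdeal R S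
  have hQ : ∀ z, z ∈ Q ↔ ∀ w, actW lam w z ∈ pairIdeal R S ∧ z ∈ pairIdeal R S := fun z => by
    simp [Q, Submodule.mem_iInf]
  have hV : ∀ v, ∀ z ∈ Q, actV v z ∈ Q := by
    intro v z hz
    rw [hQ] at hz ⊢
    refine fun w => ⟨?_, actV_mem_pairIdeal v z (hz w).2⟩
    have h := congrArg (· z) (mulMap_actW_actV (lam := lam) (w ⊗ₜ v))
    simp only [mulMap_tmul, Module.End.mul_apply] at h
    rw [h]
    induction lam (w ⊗ₜ v) with
    | zero => simp
    | add a b ha hb => simpa only [map_add, LinearMap.add_apply] using add_mem ha hb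
    | tmul v' w' =>
      rw [mulMap_tmul]
      exact actV_mem_pairIdeal v' _ (hz w').1
  suffices h : pairIdeal R S ≤ Q from fun z hz => ((hQ z).1 (h hz) w).1
  refine sup_le (Submodule.map₂_le.2 fun x hx y _ => ?_) (Submodule.map₂_le.2 fun x _ y hy => ?_)
  · rw [TensorProduct.mk_apply, relIdeal, map_toTA_map_toTP2] at *
    induction hx using Submodule.mul_induction_on' with
    | add a _ b _ ha hb => rw [TensorProduct.add_tmul]; exact add_mem ha hb
    | mem_mul_mem a ha b _ =>
      induction ha using Submodule.mul_induction_on' with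
      | add a _ b _ ha hb => rw [add_mul, TensorProduct.add_tmul]; exact add_mem ha hb
      | mem_mul_mem x _ r hr =>
        obtain ⟨r, hr, rfl⟩ := hr
        set r' := mulMap (TensorAlgebra.ι k) (TensorAlgebra.ι k) r with hr'
        have h : (x * r' * b) ⊗ₜ[k] y = (x ⊗ₜ 1) * ((r' ⊗ₜ 1) * (b ⊗ₜ y)) := by
          simp [mul_assoc]
        rw [h, hr', ← mulMap_actV_apply]
        refine tmul_one_mul_mem hV x _ ((hQ _).2 fun w => ⟨?_, compMap_actV_mem_pairIdeal hr _⟩)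
        have h := congrArg (· (b ⊗ₜ y)) (mulMap_actW_actVV (lam := lam) (w ⊗ₜ r))
        simp only [compMap_tmul (actW lam), Module.End.mul_apply] at h
        rw [h]
        obtain ⟨u, hu⟩ := hR (w ⊗ₜ r) ⟨w ⊗ₜ ⟨r, hr⟩, rfl⟩
        rw [← hu]
        clear hu
        induction u with
        | zero => simp
        | add a b ha hb => simpa only [map_add, LinearMap.add_apply] using add_mem ha hb
        | tmul r w' =>
          rw [LinearMap.rTensor_tmul, mulMap_tmul]
          exact compMap_actV_mem_pairIdeal r.2 _
  · rw [TensorProduct.mk_apply, tmul_eq_mul]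
    refine tmul_one_mul_mem hV x _ ((hQ _).2 fun w => ⟨?_, tmul_mem_pairIdeal_right _ hy⟩)
    rw [actW_one_tmul]
    exact tmul_mem_pairIdeal_right _ ((relIdeal_isTwoSided _).mul_left _ _ hy)

lemma compMap_actW_mem_pairIdeal
    (hS : ∀ t ∈ LinearMap.range (LinearMap.rTensor V S.subtype),
      moveWW lam t ∈ LinearMap.range (LinearMap.lTensor V S.subtype))
    {t : W ⊗[k] W} (ht : t ∈ S) (z : TensorAlgebra k V ⊗[k] TensorAlgebra k W) :
    compMap (actW lam) (actW lam) t z ∈ pairIdeal R S := by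
  let Q : Submodule k (TensorAlgebra k V ⊗[k] TensorAlgebra k W) :=
    ⨅ s : S, Submodule.comap (compMap (actW lam) (actW lam) s) (pairIdeal R S)
  have hQ : ∀ z, z ∈ Q ↔ ∀ s ∈ S, compMap (actW lam) (actW lam) s z ∈ pairIdeal R S :=
    fun z => by simp [Q, Submodule.mem_iInf]
  refine (hQ z).1 (mem_of_stable (fun v z hz => ?_) (fun y => ?_) z) t ht
  · rw [hQ] at hz ⊢
    intro s hs
    have h := congrArg (· z) (mulMap_actWW_actV (lam := lam) (s ⊗ₜ v))
    simp only [compMap_tmul _ actV, Module.End.mul_apply] at h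
    rw [h]
    obtain ⟨u, hu⟩ := hS (s ⊗ₜ v) ⟨⟨s, hs⟩ ⊗ₜ v, rfl⟩
    rw [← hu]
    clear hu
    induction u with
    | zero => simp
    | add a b ha hb => simpa only [map_add, LinearMap.add_apply] using add_mem ha hb
    | tmul v' s =>
      rw [LinearMap.lTensor_tmul, mulMap_tmul]
      exact actV_mem_pairIdeal v' _ (hz _ s.2)
  · rw [hQ]
    intro s hs
    rw [mulMap_actW_one_tmul]
    exact tmul_mem_pairIdeal_right _
      ((relIdeal_isTwoSided _).mul_right _ _ (mulMap_ι_mem_relIdeal hs))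

lemma mulMap_map {X X' Y Y' E : Type*} [AddCommGroup X] [Module k X] [AddCommGroup X']
    [Module k X'] [AddCommGroup Y] [Module k Y] [AddCommGroup Y'] [Module k Y'] [Ring E]
    [Algebra k E] (f : X →ₗ[k] E) (g : Y →ₗ[k] E) (a : X' →ₗ[k] X) (b : Y' →ₗ[k] Y)
    (t : X' ⊗[k] Y') :
    mulMap f g (TensorProduct.map a b t) = mulMap (f ∘ₗ a) (g ∘ₗ b) t := by
  simp [mulMap, TensorProduct.map_comp]

/-- The quadratic relations of `P`, in the tensor algebra. -/
lemma map_toTA_relP :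
    Submodule.map (toTA 2) (relP k V W R S lam) =
      Submodule.map (mulMap (letterV k V W) (letterV k V W)) R ⊔
        LinearMap.range (mulMap (letterW k V W) (letterV k V W) -
          mulMap (letterV k V W) (letterW k V W) ∘ₗ lam) ⊔
        Submodule.map (mulMap (letterW k V W) (letterW k V W)) S := by
  have h₁ : ∀ {X Y : Type} [AddCommGroup X] [Module k X] [AddCommGroup Y] [Module k Y]
      (f : X →ₗ[k] V × W) (g : Y →ₗ[k] V × W),
      toTA 2 ∘ₗ (toTP2 k (V × W)).toLinearMap ∘ₗ TensorProduct.map f g =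
        mulMap (TensorAlgebra.ι k ∘ₗ f) (TensorAlgebra.ι k ∘ₗ g) := fun f g =>
    LinearMap.ext fun t => (toTA_toTP2 _).trans (mulMap_map _ _ _ _ t)
  rw [relP, Submodule.map_sup, Submodule.map_sup, embRR, embD, embSS, ← Submodule.map_comp,
    ← Submodule.map_comp, ← LinearMap.range_comp, LinearMap.comp_sub, ← LinearMap.comp_assoc lam,
    h₁, h₁, h₁, h₁]
  rfl

lemma mulMap_letterV_mem {t : V ⊗[k] V} (ht : t ∈ R) :
    mulMap (letterV k V W) (letterV k V W) t ∈ relIdeal (relP k V W R S lam) := by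
  refine le_top_mul_mul_top _ ?_
  rw [map_toTA_relP]
  exact Submodule.mem_sup_left (Submodule.mem_sup_left (Submodule.mem_map_of_mem ht))

lemma mulMap_letterW_mem {t : W ⊗[k] W} (ht : t ∈ S) :
    mulMap (letterW k V W) (letterW k V W) t ∈ relIdeal (relP k V W R S lam) := by
  refine le_top_mul_mul_top _ ?_
  rw [map_toTA_relP]
  exact Submodule.mem_sup_right (Submodule.mem_map_of_mem ht)

lemma mulMap_letterW_letterV_sub_mem (t : W ⊗[k] V) :
    mulMap (letterW k V W) (letterV k V W) t - mulMap (letterV k V W) (letterW k V W) (lam t) ∈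
      relIdeal (relP k V W R S lam) := by
  refine le_top_mul_mul_top _ ?_
  rw [map_toTA_relP]
  exact Submodule.mem_sup_left (Submodule.mem_sup_right ⟨t, rfl⟩)

lemma act_mem_pairIdeal
    (hR : ∀ t ∈ LinearMap.range (LinearMap.lTensor W R.subtype),
      moveVV lam t ∈ LinearMap.range (LinearMap.rTensor W R.subtype))
    (a : TensorAlgebra k (V × W)) : ∀ z ∈ pairIdeal R S, act lam a z ∈ pairIdeal R S := by
  induction a using TensorAlgebra.induction with
  | algebraMap r =>
    intro z hz
    rw [AlgHom.commutes, Module.algebraMap_end_apply]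
    exact Submodule.smul_mem _ r hz
  | ι u =>
    intro z hz
    rw [ι_eq_letterV_add_letterW, map_add, act_letterV, act_letterW, LinearMap.add_apply]
    exact add_mem (actV_mem_pairIdeal _ z hz) (actW_mem_pairIdeal hR _ z hz)
  | mul a b ha hb =>
    intro z hz
    rw [map_mul]
    exact ha _ (hb _ hz)
  | add a b ha hb =>
    intro z hz
    rw [map_add]
    exact add_mem (ha z hz) (hb z hz)

/-- The ideal of relations of `P` acts on `T(V) ⊗ T(W)` with values in the relations of
`A ⊗ B`. -/
lemma act_mem_pairIdeal_of_mem_relIdeal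
    (hR : ∀ t ∈ LinearMap.range (LinearMap.lTensor W R.subtype),
      moveVV lam t ∈ LinearMap.range (LinearMap.rTensor W R.subtype))
    (hS : ∀ t ∈ LinearMap.range (LinearMap.rTensor V S.subtype),
      moveWW lam t ∈ LinearMap.range (LinearMap.lTensor V S.subtype))
    {a : TensorAlgebra k (V × W)} (ha : a ∈ relIdeal (relP k V W R S lam))
    (z : TensorAlgebra k V ⊗[k] TensorAlgebra k W) : act lam a z ∈ pairIdeal R S := by
  have hrel : Submodule.map (toTA 2) (relP k V W R S lam) ≤
      Submodule.comap (act lam).toLinearMap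
        (⨅ z, Submodule.comap (LinearMap.applyₗ z) (pairIdeal R S)) := by
    rw [map_toTA_relP]
    refine sup_le (sup_le ?_ ?_) ?_
    · rintro _ ⟨r, hr, rfl⟩
      simp only [Submodule.mem_comap, Submodule.mem_iInf, AlgHom.toLinearMap_apply,
        act_mulMap act_letterV act_letterV]
      exact fun z => compMap_actV_mem_pairIdeal hr z
    · rintro _ ⟨t, rfl⟩
      simp only [Submodule.mem_comap, Submodule.mem_iInf, AlgHom.toLinearMap_apply,
        LinearMap.sub_apply, LinearMap.comp_apply, map_sub,
        act_mulMap act_letterV act_letterW, act_mulMap act_letterW act_letterV,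
        mulMap_actW_actV, sub_self]
      exact fun z => zero_mem _
    · rintro _ ⟨s, hs, rfl⟩
      simp only [Submodule.mem_comap, Submodule.mem_iInf, AlgHom.toLinearMap_apply,
        act_mulMap act_letterW act_letterW]
      exact fun z => compMap_actW_mem_pairIdeal hS hs z
  rw [relIdeal] at ha
  induction ha using Submodule.mul_induction_on' generalizing z with
  | add a _ b _ ha hb => rw [map_add]; exact add_mem (ha z) (hb z)
  | mem_mul_mem a ha b _ =>
    rw [map_mul, Module.End.mul_apply]
    generalize act lam b z = z'
    induction ha using Submodule.mul_induction_on' generalizing z' with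
    | add a _ b _ ha hb => rw [map_add]; exact add_mem (ha z') (hb z')
    | mem_mul_mem x _ r hr =>
      rw [map_mul, Module.End.mul_apply]
      exact act_mem_pairIdeal hR x _ ((Submodule.mem_iInf _).1 (hrel hr) z')

/-- Modulo the relations of `P`, the action on `T(V) ⊗ T(W)` computes products in `T(V ⊕ W)`. -/
lemma mul_mulVW_sub_mem (a : TensorAlgebra k (V × W)) :
    ∀ z, a * mulVW k V W z - mulVW k V W (act lam a z) ∈ relIdeal (relP k V W R S lam) := by
  have hI := relIdeal_isTwoSided (relP k V W R S lam)
  induction a using TensorAlgebra.induction with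
  | algebraMap r =>
    intro z
    rw [AlgHom.commutes, Module.algebraMap_end_apply, map_smul, Algebra.smul_def, sub_self]
    exact zero_mem _
  | ι u =>
    have hW : ∀ z w, letterW k V W w * mulVW k V W z - mulVW k V W (actW lam w z) ∈
        relIdeal (relP k V W R S lam) := by
      intro z
      let Q : Submodule k (TensorAlgebra k V ⊗[k] TensorAlgebra k W) :=
        ⨅ w, Submodule.comap (LinearMap.mulLeft k (letterW k V W w) ∘ₗ mulVW k V W -
          mulVW k V W ∘ₗ actW lam w) (relIdeal (relP k V W R S lam))
      have hQ : ∀ z, z ∈ Q ↔ ∀ w, letterW k V W w * mulVW k V W z - mulVW k V W (actW lam w z) ∈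
          relIdeal (relP k V W R S lam) := fun z => by simp [Q, Submodule.mem_iInf]
      refine (hQ z).1 (mem_of_stable (fun v z hz => ?_) (fun y => ?_) z)
      · rw [hQ] at hz ⊢
        intro w
        have h := congrArg (· z) (mulMap_actW_actV (lam := lam) (w ⊗ₜ v))
        simp only [mulMap_tmul, Module.End.mul_apply] at h
        rw [h, mulVW_actV, ← mul_assoc]
        have h₁ := hI.mul_right (mulVW k V W z) _
          (mulMap_letterW_letterV_sub_mem (R := R) (S := S) (lam := lam) (w ⊗ₜ v))
        have h₂ : ∀ t, mulMap (letterV k V W) (letterW k V W) t * mulVW k V W z -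
            mulVW k V W (compMap actV (actW lam) t z) ∈ relIdeal (relP k V W R S lam) := by
          intro t
          induction t with
          | zero => simp
          | add a b ha hb =>
            simp only [map_add, LinearMap.add_apply, add_mul]
            rw [add_sub_add_comm]
            exact add_mem ha hb
          | tmul v' w' =>
            rw [mulMap_tmul, mulMap_tmul, Module.End.mul_apply, mulVW_actV, mul_assoc, ← mul_sub]
            exact hI.mul_left _ _ (hz w')
        have h₃ := add_mem h₁ (h₂ (lam (w ⊗ₜ v)))
        rwa [mulMap_tmul, sub_mul, sub_add_sub_cancel] at h₃
      · rw [hQ]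
        intro w
        rw [actW_one_tmul, mulVW_tmul, mulVW_tmul, map_one, one_mul, one_mul, map_mul, mapTA_ι]
        exact (sub_self (letterW k V W w * _)).symm ▸ zero_mem _
    intro z
    rw [ι_eq_letterV_add_letterW, map_add, act_letterV, act_letterW, LinearMap.add_apply, map_add,
      mulVW_actV, add_mul, add_sub_add_left_eq_sub]
    exact hW z u.2
  | mul a b ha hb =>
    intro z
    have h := add_mem (hI.mul_left a _ (hb z)) (ha (act lam b z))
    rwa [mul_sub, sub_add_sub_cancel, ← mul_assoc, ← Module.End.mul_apply, ← map_mul] at h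
  | add a b ha hb =>
    intro z
    rw [map_add, LinearMap.add_apply, map_add, add_mul, add_sub_add_comm]
    exact add_mem (ha z) (hb z)

lemma sub_mulVW_act_one_mem (a : TensorAlgebra k (V × W)) :
    a - mulVW k V W (act lam a (1 ⊗ₜ 1)) ∈ relIdeal (relP k V W R S lam) := by
  have h := mul_mulVW_sub_mem (R := R) (S := S) (lam := lam) a (1 ⊗ₜ 1)
  rwa [mulVW_tmul, map_one, map_one, mul_one, mul_one] at h

end Ideals

section ReplacementRule

variable {k V W R S lam}

variable (k V W) in
/-- The concatenation map `V^{⊗a} ⊗ W^{⊗b} → (V ⊕ W)^{⊗(a+b)}`. -/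
def wordMul (a b : ℕ) : (↥(TP k V a) ⊗[k] ↥(TP k W b)) →ₗ[k] ↥(TP k (V × W) (a + b)) :=
  (concatEquiv k (V × W) a b).toLinearMap ∘ₗ
    TensorProduct.map (TPmap k (LinearMap.inl k V W) a) (TPmap k (LinearMap.inr k V W) b)

lemma multVW_apply (a b : ℕ) (t : ↥(TP k V a) ⊗[k] ↥(TP k W b)) :
    multVW k V W R S lam a b t = Submodule.Quotient.mk (wordMul k V W a b t) := rfl

lemma toTA_wordMul (a b : ℕ) (t : ↥(TP k V a) ⊗[k] ↥(TP k W b)) :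
    toTA (a + b) (wordMul k V W a b t) =
      mulVW k V W (TensorProduct.map (toTA a) (toTA b) t) := by
  induction t with
  | zero => simp
  | add x y hx hy => simp only [map_add, hx, hy]
  | tmul x y =>
    rw [TensorProduct.map_tmul, mulVW_tmul, ← toTA_TPmap, ← toTA_TPmap, ← toTA_concatEquiv]
    rfl

lemma mem_ker_multVW_iff {a b : ℕ} {t : ↥(TP k V a) ⊗[k] ↥(TP k W b)} :
    t ∈ LinearMap.ker (multVW k V W R S lam a b) ↔
      mulVW k V W (TensorProduct.map (toTA a) (toTA b) t) ∈ relIdeal (relP k V W R S lam) := by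
  rw [← toTA_wordMul, toTA_mem_relIdeal_iff, LinearMap.mem_ker, multVW_apply,
    Submodule.Quotient.mk_eq_zero]

lemma mapTA_toTA_toTP2 (f : V →ₗ[k] W) (t : V ⊗[k] V) :
    mapTA f (toTA 2 (toTP2 k V t)) =
      mulMap (TensorAlgebra.ι k ∘ₗ f) (TensorAlgebra.ι k ∘ₗ f) t := by
  rw [toTA_toTP2]
  induction t with
  | zero => simp
  | add x y hx hy => simp only [map_add, hx, hy]
  | tmul x y => simp

variable (k V) in
/-- The canonical identification `V ≅ TP k V 1`. -/
def toTP1 : V ≃ₗ[k] ↥(TP k V 1) := LinearEquiv.refl k V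

lemma mapTA_toTA_toTP1 (f : V →ₗ[k] W) (v : V) :
    mapTA f (toTA 1 (toTP1 k V v)) = TensorAlgebra.ι k (f v) :=
  mapTA_ι f v

lemma moveVV_mem_of_isReplacementRule (h : IsReplacementRule k V W R S lam)
    (t : W ⊗[k] (V ⊗[k] V)) (ht : t ∈ LinearMap.range (LinearMap.lTensor W R.subtype)) :
    moveVV lam t ∈ LinearMap.range (LinearMap.rTensor W R.subtype) := by
  have hI := relIdeal_isTwoSided (relP k V W R S lam)
  let e := TensorProduct.congr (toTP2 k V) (toTP1 k W)
  have hmul : ∀ u, mulVW k V W (TensorProduct.map (toTA 2) (toTA 1) (e u)) =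
      mulMap (mulMap (letterV k V W) (letterV k V W)) (letterW k V W) u := by
    intro u
    induction u with
    | zero => simp
    | add x y hx hy => simp only [map_add, hx, hy]
    | tmul x y =>
      rw [TensorProduct.congr_tmul, TensorProduct.map_tmul, mulVW_tmul, mapTA_toTA_toTP1,
        mapTA_toTA_toTP2, mulMap_tmul]
      rfl
  have hmem : e (moveVV lam t) ∈ denVW k V W R S 2 1 := by
    rw [← h.2, mem_ker_multVW_iff, hmul]
    have h₁ := mulMap_mem_of_mem_range_lTensor hI (f := letterW k V W)
      (fun r hr => mulMap_letterV_mem (R := R) (S := S) (lam := lam) hr) ht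
    have h₂ := mulMap_moveVV_sub_mem hI mulMap_letterW_letterV_sub_mem t
    exact (Submodule.sub_mem_iff_right _ h₁).1 h₂
  have hle : denVW k V W R S 2 1 ≤ Submodule.comap e.symm.toLinearMap
      (LinearMap.range (LinearMap.rTensor W R.subtype)) := by
    refine sup_le ?_ ?_
    · rintro _ ⟨u, rfl⟩
      induction u with
      | zero => simp
      | add x y hx hy => simpa only [map_add] using add_mem hx hy
      | tmul x y =>
        obtain ⟨r, hr, hrx⟩ := RelOf_two_le _ x.2
        refine ⟨⟨r, hr⟩ ⊗ₜ (toTP1 k W).symm y, ?_⟩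
        change r ⊗ₜ _ = (toTP2 k V).symm x ⊗ₜ _
        rw [← hrx]
        simp
    · rintro _ ⟨u, rfl⟩
      induction u with
      | zero => simp
      | add x y hx hy => simpa only [map_add] using add_mem hx hy
      | tmul x y =>
        have hy : (y : ↥(TP k W 1)) = 0 := (Submodule.mem_bot k).1 ((RelOf_one _).le y.2)
        simp [hy]
  simpa using hle hmem

lemma moveWW_mem_of_isReplacementRule (h : IsReplacementRule k V W R S lam)
    (t : (W ⊗[k] W) ⊗[k] V) (ht : t ∈ LinearMap.range (LinearMap.rTensor V S.subtype)) :
    moveWW lam t ∈ LinearMap.range (LinearMap.lTensor V S.subtype) := by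
  have hI := relIdeal_isTwoSided (relP k V W R S lam)
  let e := TensorProduct.congr (toTP1 k V) (toTP2 k W)
  have hmul : ∀ u, mulVW k V W (TensorProduct.map (toTA 1) (toTA 2) (e u)) =
      mulMap (letterV k V W) (mulMap (letterW k V W) (letterW k V W)) u := by
    intro u
    induction u with
    | zero => simp
    | add x y hx hy => simp only [map_add, hx, hy]
    | tmul x y =>
      rw [TensorProduct.congr_tmul, TensorProduct.map_tmul, mulVW_tmul, mapTA_toTA_toTP1,
        mapTA_toTA_toTP2, mulMap_tmul]
      rfl
  have hmem : e (moveWW lam t) ∈ denVW k V W R S 1 2 := by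
    rw [← h.1, mem_ker_multVW_iff, hmul]
    have h₁ := mulMap_mem_of_mem_range_rTensor hI (g := letterV k V W)
      (fun s hs => mulMap_letterW_mem (R := R) (S := S) (lam := lam) hs) ht
    have h₂ := mulMap_moveWW_sub_mem hI mulMap_letterW_letterV_sub_mem t
    exact (Submodule.sub_mem_iff_right _ h₁).1 h₂
  have hle : denVW k V W R S 1 2 ≤ Submodule.comap e.symm.toLinearMap
      (LinearMap.range (LinearMap.lTensor V S.subtype)) := by
    refine sup_le ?_ ?_
    · rintro _ ⟨u, rfl⟩
      induction u with
      | zero => simp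
      | add x y hx hy => simpa only [map_add] using add_mem hx hy
      | tmul x y =>
        have hx : (x : ↥(TP k V 1)) = 0 := (Submodule.mem_bot k).1 ((RelOf_one _).le x.2)
        simp [hx]
    · rintro _ ⟨u, rfl⟩
      induction u with
      | zero => simp
      | add x y hx hy => simpa only [map_add] using add_mem hx hy
      | tmul x y =>
        obtain ⟨s, hs, hsy⟩ := RelOf_two_le _ y.2
        refine ⟨(toTP1 k V).symm x ⊗ₜ ⟨s, hs⟩, ?_⟩
        change _ ⊗ₜ s = _ ⊗ₜ (toTP2 k W).symm y
        rw [← hsy]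
        simp
  simpa using hle hmem

end ReplacementRule

section Total

variable {k V W R S lam}

variable (k V W) in
/-- The total concatenation map `⊕_{a+b=d} V^{⊗a} ⊗ W^{⊗b} → (V ⊕ W)^{⊗d}`. -/
def wordTotal (d : ℕ) :
    (DirectSum {ab : ℕ × ℕ // ab.1 + ab.2 = d}
        fun ab => ↥(TP k V ab.1.1) ⊗[k] ↥(TP k W ab.1.2)) →ₗ[k] ↥(TP k (V × W) d) :=
  DirectSum.toModule k _ _ fun ab => castWord ab.2 ∘ₗ wordMul k V W ab.1.1 ab.1.2

variable (k V W) in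
/-- The embedding of `⊕_{a+b=d} V^{⊗a} ⊗ W^{⊗b}` in `T(V) ⊗ T(W)`. -/
def pairTotal (d : ℕ) :
    (DirectSum {ab : ℕ × ℕ // ab.1 + ab.2 = d}
        fun ab => ↥(TP k V ab.1.1) ⊗[k] ↥(TP k W ab.1.2)) →ₗ[k]
      (TensorAlgebra k V ⊗[k] TensorAlgebra k W) :=
  DirectSum.toModule k _ _ fun ab => TensorProduct.map (toTA ab.1.1) (toTA ab.1.2)

lemma castP_mk {m n : ℕ} (h : m = n) (x : ↥(TP k (V × W) m)) :
    castP k V W R S lam h (Submodule.Quotient.mk x) = Submodule.Quotient.mk (castWord h x) := by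
  subst h
  rfl

lemma multTotal_eq (d : ℕ) :
    multTotal k V W R S lam d =
      (RelOf k (V × W) (relP k V W R S lam) d).mkQ ∘ₗ wordTotal k V W d := by
  refine DirectSum.linearMap_ext k fun ab => LinearMap.ext fun t => ?_
  simp only [multTotal, wordTotal, LinearMap.comp_apply, DirectSum.toModule_lof, multVW_apply,
    castP_mk, Submodule.mkQ_apply]

lemma toTA_wordTotal (d : ℕ) (z : DirectSum {ab : ℕ × ℕ // ab.1 + ab.2 = d}
    fun ab => ↥(TP k V ab.1.1) ⊗[k] ↥(TP k W ab.1.2)) :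
    toTA d (wordTotal k V W d z) = mulVW k V W (pairTotal k V W d z) := by
  suffices h : toTA d ∘ₗ wordTotal k V W d = mulVW k V W ∘ₗ pairTotal k V W d from
    LinearMap.congr_fun h z
  refine DirectSum.linearMap_ext k fun ab => LinearMap.ext fun t => ?_
  simp only [wordTotal, pairTotal, LinearMap.comp_apply, DirectSum.toModule_lof, toTA_castWord,
    toTA_wordMul]

lemma mem_ker_multTotal_iff {d : ℕ} {z : DirectSum {ab : ℕ × ℕ // ab.1 + ab.2 = d}
    fun ab => ↥(TP k V ab.1.1) ⊗[k] ↥(TP k W ab.1.2)} :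
    z ∈ LinearMap.ker (multTotal k V W R S lam d) ↔
      mulVW k V W (pairTotal k V W d z) ∈ relIdeal (relP k V W R S lam) := by
  rw [← toTA_wordTotal, toTA_mem_relIdeal_iff, LinearMap.mem_ker, multTotal_eq,
    LinearMap.comp_apply, Submodule.mkQ_apply, Submodule.Quotient.mk_eq_zero]

lemma map_projTA_pairTotal {d : ℕ} (ab : {ab : ℕ × ℕ // ab.1 + ab.2 = d})
    (z : DirectSum {ab : ℕ × ℕ // ab.1 + ab.2 = d}
      fun ab => ↥(TP k V ab.1.1) ⊗[k] ↥(TP k W ab.1.2)) :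
    TensorProduct.map (projTA ab.1.1) (projTA ab.1.2) (pairTotal k V W d z) = z ab := by
  suffices h : TensorProduct.map (projTA ab.1.1) (projTA ab.1.2) ∘ₗ pairTotal k V W d =
      DirectSum.component k _ _ ab from LinearMap.congr_fun h z
  refine DirectSum.linearMap_ext k fun cd => TensorProduct.ext' fun x y => ?_
  simp only [LinearMap.comp_apply, pairTotal, DirectSum.toModule_lof, TensorProduct.map_tmul]
  by_cases h : cd = ab
  · subst h
    rw [projTA_toTA, projTA_toTA, DirectSum.component.lof_self]
  · have hne : cd.1.1 ≠ ab.1.1 := by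
      intro h'
      refine h (Subtype.ext (Prod.ext h' ?_))
      have := cd.2
      have := ab.2
      omega
    rw [projTA_toTA_of_ne hne, TensorProduct.zero_tmul, DirectSum.component.of, dif_neg h]

lemma map_projTA_mem_denVW (a b : ℕ) {z : TensorAlgebra k V ⊗[k] TensorAlgebra k W}
    (hz : z ∈ pairIdeal R S) :
    TensorProduct.map (projTA a) (projTA b) z ∈ denVW k V W R S a b := by
  suffices h : pairIdeal R S ≤
      Submodule.comap (TensorProduct.map (projTA a) (projTA b)) (denVW k V W R S a b) from h hz
  refine sup_le (Submodule.map₂_le.2 fun x hx y _ => ?_) (Submodule.map₂_le.2 fun x _ y hy => ?_)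
  · exact Submodule.mem_sup_left ⟨⟨_, projTA_mem_RelOf a hx⟩ ⊗ₜ projTA b y, rfl⟩
  · exact Submodule.mem_sup_right ⟨projTA a x ⊗ₜ ⟨_, projTA_mem_RelOf b hy⟩, rfl⟩

lemma mapTA_mem_relIdeal {f : V →ₗ[k] W} {U : Submodule k (V ⊗[k] V)}
    {I : Submodule k (TensorAlgebra k W)} (hI : IsTwoSidedSubspace I)
    (hU : ∀ t ∈ U, mulMap (TensorAlgebra.ι k ∘ₗ f) (TensorAlgebra.ι k ∘ₗ f) t ∈ I)
    {x : TensorAlgebra k V} (hx : x ∈ relIdeal (Submodule.map (toTP2 k V).toLinearMap U)) :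
    mapTA f x ∈ I := by
  rw [relIdeal] at hx
  induction hx using Submodule.mul_induction_on' with
  | add a _ b _ ha hb => rw [map_add]; exact add_mem ha hb
  | mem_mul_mem a ha b _ =>
    rw [map_mul]
    refine hI.mul_right _ _ ?_
    induction ha using Submodule.mul_induction_on' with
    | add a _ b _ ha hb => rw [map_add]; exact add_mem ha hb
    | mem_mul_mem x _ r hr =>
      obtain ⟨_, ⟨r, hr, rfl⟩, rfl⟩ := hr
      rw [map_mul]
      refine hI.mul_left _ _ ?_
      rw [LinearEquiv.coe_coe, mapTA_toTA_toTP2]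
      exact hU r hr

lemma mulVW_mem_relIdeal {a b : ℕ} {t : ↥(TP k V a) ⊗[k] ↥(TP k W b)}
    (ht : t ∈ denVW k V W R S a b) :
    mulVW k V W (TensorProduct.map (toTA a) (toTA b) t) ∈ relIdeal (relP k V W R S lam) := by
  have hI := relIdeal_isTwoSided (relP k V W R S lam)
  suffices h : denVW k V W R S a b ≤ Submodule.comap
      (mulVW k V W ∘ₗ TensorProduct.map (toTA a) (toTA b)) (relIdeal (relP k V W R S lam)) from
    h ht
  refine sup_le ?_ ?_
  · rintro _ ⟨u, rfl⟩
    induction u with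
    | zero => simp
    | add x y hx hy => simpa only [map_add] using add_mem hx hy
    | tmul x y =>
      change mulVW k V W (toTA a (x : ↥(TP k V a)) ⊗ₜ toTA b y) ∈
        relIdeal (relP k V W R S lam)
      rw [mulVW_tmul]
      exact hI.mul_right _ _ (mapTA_mem_relIdeal hI (fun t ht => mulMap_letterV_mem ht)
        (toTA_mem_relIdeal x.2))
  · rintro _ ⟨u, rfl⟩
    induction u with
    | zero => simp
    | add x y hx hy => simpa only [map_add] using add_mem hx hy
    | tmul x y =>
      change mulVW k V W (toTA a x ⊗ₜ toTA b (y : ↥(TP k W b))) ∈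
        relIdeal (relP k V W R S lam)
      rw [mulVW_tmul]
      exact hI.mul_left _ _ (mapTA_mem_relIdeal hI (fun t ht => mulMap_letterW_mem ht)
        (toTA_mem_relIdeal y.2))

lemma projTA_mulVW_mem_range (d : ℕ) (z : TensorAlgebra k V ⊗[k] TensorAlgebra k W) :
    projTA d (mulVW k V W z) ∈ LinearMap.range (wordTotal k V W d) := by
  suffices h : Submodule.map₂ (TensorProduct.mk k (TensorAlgebra k V) (TensorAlgebra k W)) ⊤ ⊤ ≤
      Submodule.comap (projTA d ∘ₗ mulVW k V W) (LinearMap.range (wordTotal k V W d)) by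
    rw [TensorProduct.map₂_mk_top_top_eq_top] at h
    exact h trivial
  rw [← iSup_range_toTA, ← iSup_range_toTA, Submodule.map₂_iSup_left]
  refine iSup_le fun a => ?_
  rw [Submodule.map₂_iSup_right]
  refine iSup_le fun b => Submodule.map₂_le.2 ?_
  rintro _ ⟨x, rfl⟩ _ ⟨y, rfl⟩
  rw [Submodule.mem_comap, LinearMap.comp_apply, TensorProduct.mk_apply, ← TensorProduct.map_tmul,
    ← toTA_wordMul]
  by_cases h : a + b = d
  · subst h
    rw [projTA_toTA]
    refine ⟨DirectSum.lof k _ (fun ab : {ab : ℕ × ℕ // ab.1 + ab.2 = a + b} =>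
      ↥(TP k V ab.1.1) ⊗[k] ↥(TP k W ab.1.2)) ⟨(a, b), rfl⟩ (x ⊗ₜ y), ?_⟩
    rw [wordTotal, DirectSum.toModule_lof]
    rfl
  · rw [projTA_toTA_of_ne h]
    exact zero_mem _

lemma range_multTotal (d : ℕ) : LinearMap.range (multTotal k V W R S lam d) = ⊤ := by
  rw [LinearMap.range_eq_top]
  intro q
  obtain ⟨x, rfl⟩ := Submodule.Quotient.mk_surjective _ q
  obtain ⟨z, hz⟩ := projTA_mulVW_mem_range (k := k) d (act lam (toTA d x) (1 ⊗ₜ 1))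
  refine ⟨z, ?_⟩
  rw [multTotal_eq, LinearMap.comp_apply, Submodule.mkQ_apply, hz]
  symm
  rw [Submodule.Quotient.eq]
  have h := projTA_mem_RelOf d
    (sub_mulVW_act_one_mem (R := R) (S := S) (lam := lam) (toTA d x))
  rwa [map_sub, projTA_toTA] at h

end Total

/-- **Multiplication induces `A ⊗ B ≅ P`.**  If `λ` is a replacement rule then, for every `d`,
the map `⊕_{a+b=d} A_a ⊗ B_b → P_d` induced by multiplication in `P` is an isomorphism: the
total map `multTotal d` on representatives is surjective, and its kernel is exactly the canonical
kernel `⊕_{a+b=d} ((Rel_A a) ⊗ W^{⊗b} + V^{⊗a} ⊗ (Rel_B b))` of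
`⊕ (V^{⊗a} ⊗ W^{⊗b}) → ⊕ (A_a ⊗ B_b)`. -/
theorem statement11 (hrr : IsReplacementRule k V W R S lam) :
    ∀ d : ℕ,
      LinearMap.range (multTotal k V W R S lam d) = ⊤ ∧
      LinearMap.ker (multTotal k V W R S lam d) =
        ⨆ ab : {ab : ℕ × ℕ // ab.1 + ab.2 = d},
          Submodule.map
            (DirectSum.lof k {ab : ℕ × ℕ // ab.1 + ab.2 = d}
              (fun ab => ↥(TP k V ab.1.1) ⊗[k] ↥(TP k W ab.1.2)) ab)
            (denVW k V W R S ab.1.1 ab.1.2) := by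
  refine fun d => ⟨range_multTotal d, le_antisymm (fun z hz => ?_) (iSup_le fun ab => ?_)⟩
  · rw [mem_ker_multTotal_iff] at hz
    have hK := act_mem_pairIdeal_of_mem_relIdeal (moveVV_mem_of_isReplacementRule hrr)
      (moveWW_mem_of_isReplacementRule hrr) hz (1 ⊗ₜ 1)
    rw [act_mulVW_one] at hK
    classical
    rw [← DirectSum.sum_support_of z]
    refine Submodule.sum_mem _ fun ab _ => Submodule.mem_iSup_of_mem ab ?_
    refine Submodule.mem_map_of_mem (f := DirectSum.lof k _ _ ab) ?_
    rw [← map_projTA_pairTotal]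
    exact map_projTA_mem_denVW _ _ hK
  · rintro _ ⟨t, ht, rfl⟩
    rw [mem_ker_multTotal_iff, pairTotal, DirectSum.toModule_lof]
    exact mulVW_mem_relIdeal ht

end Quadratic
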